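/- arXiv:2107.02577 — 6 statements merged into one kernel-verified Lean document; each statement's English description precedes it below -/
import Mathlib

section
/- For every family F ⊆ ℕ → ℕ, the van Douwen space X_F is developable: there exists a sequence (𝒪_n)_{n∈ℕ} of open covers of X_F such that for every x ∈ X_F and every closed C ⊆ X_F with x ∉ C there is n ∈ ℕ such that every member of 𝒪_n containing x is disjoint from C. -/
/-- The underlying type of the van Douwen space `X_F`:
the disjoint union `F ⊔ ℕ ⊔ (F × ℕ × ℕ)`. -/
def VDSpace (F : Set (ℕ → ℕ)) : Type := (↥F ⊕ ℕ) ⊕ (↥F × ℕ × ℕ)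

namespace VDSpace

variable {F : Set (ℕ → ℕ)}

/-- The (isolated) points of `X_F` coming from `F × ℕ × ℕ`. -/
def pt (p : ↥F × ℕ × ℕ) : VDSpace F := Sum.inr p

/-- The points of `X_F` coming from functions in `F`. -/
def fn (f : ↥F) : VDSpace F := Sum.inl (Sum.inl f)

/-- The points of `X_F` coming from natural numbers. -/
def nat (k : ℕ) : VDSpace F := Sum.inl (Sum.inr k)

/-- The basic neighborhood `O_{f,s} = {f} ∪ {(f, m, n) : f m = n, (m, n) ∉ s}` of `fn f`. -/
def basicO (f : ↥F) (s : Finset (ℕ × ℕ)) : Set (VDSpace F) :=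
  {fn f} ∪ {x | ∃ m n : ℕ, (f : ℕ → ℕ) m = n ∧ (m, n) ∉ s ∧ x = pt (f, m, n)}

/-- The basic neighborhood `U_{k,n} = {k} ∪ {(g, k, l) : g ∈ F, l ≥ n}` of `nat k`. -/
def basicU (k n : ℕ) : Set (VDSpace F) :=
  {nat k} ∪ {x | ∃ (g : ↥F) (l : ℕ), n ≤ l ∧ x = pt (g, k, l)}

/-- The topology of the van Douwen space: every point of `F × ℕ × ℕ` is isolated,
the sets `O_{f,s}` form a neighborhood basis of `f ∈ F`, and the sets `U_{k,n}` form a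
neighborhood basis of `k ∈ ℕ`. -/
instance instTopVD (F : Set (ℕ → ℕ)) : TopologicalSpace (VDSpace F) :=
  TopologicalSpace.generateFrom
    ({V | ∃ p : ↥F × ℕ × ℕ, V = {pt p}} ∪
     {V | ∃ (f : ↥F) (s : Finset (ℕ × ℕ)), V = basicO f s} ∪
     {V | ∃ k n : ℕ, V = (basicU k n : Set (VDSpace F))})

end VDSpace

/-- A development of a topological space `X`: a sequence `𝒪` of open covers of `X` such that
for every point `x ∈ X` and every closed set `C ⊆ X` with `x ∉ C` there exists `n` such that
every member of `𝒪 n` containing `x` is disjoint from `C`. -/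
def IsDevelopment {X : Type*} [TopologicalSpace X] (𝒪 : ℕ → Set (Set X)) : Prop :=
  (∀ n, ∀ U ∈ 𝒪 n, IsOpen U) ∧ (∀ n, ⋃₀ 𝒪 n = Set.univ) ∧
  ∀ (x : X) (C : Set X), IsClosed C → x ∉ C → ∃ n, ∀ U ∈ 𝒪 n, x ∈ U → Disjoint U C

namespace VDSpace

variable {F : Set (ℕ → ℕ)}

/-- The `n`-th basic neighborhood of a point of `X_F`. -/
def basicNhd (n : ℕ) : VDSpace F → Set (VDSpace F)
  | Sum.inl (Sum.inl f) => basicO f ((Finset.range n).image fun m => (m, (f : ℕ → ℕ) m))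
  | Sum.inl (Sum.inr k) => basicU k n
  | Sum.inr p => {pt p}

@[simp] theorem pt_inj {p q : ↥F × ℕ × ℕ} : (pt p : VDSpace F) = pt q ↔ p = q :=
  Sum.inr_injective.eq_iff

@[simp] theorem fn_inj {f g : ↥F} : (fn f : VDSpace F) = fn g ↔ f = g :=
  (Sum.inl_injective.comp Sum.inl_injective).eq_iff

@[simp] theorem nat_inj {k l : ℕ} : (nat k : VDSpace F) = nat l ↔ k = l :=
  (Sum.inl_injective.comp Sum.inr_injective).eq_iff

@[simp] theorem fn_ne_pt (f : ↥F) (p : ↥F × ℕ × ℕ) : (fn f : VDSpace F) ≠ pt p := Sum.inl_ne_inr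

@[simp] theorem pt_ne_fn (f : ↥F) (p : ↥F × ℕ × ℕ) : (pt p : VDSpace F) ≠ fn f := Sum.inr_ne_inl

@[simp] theorem nat_ne_pt (k : ℕ) (p : ↥F × ℕ × ℕ) : (nat k : VDSpace F) ≠ pt p := Sum.inl_ne_inr

@[simp] theorem pt_ne_nat (k : ℕ) (p : ↥F × ℕ × ℕ) : (pt p : VDSpace F) ≠ nat k := Sum.inr_ne_inl

@[simp] theorem fn_ne_nat (f : ↥F) (k : ℕ) : (fn f : VDSpace F) ≠ nat k :=
  fun h => Sum.inl_ne_inr (Sum.inl_injective h)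

@[simp] theorem nat_ne_fn (f : ↥F) (k : ℕ) : (nat k : VDSpace F) ≠ fn f :=
  fun h => Sum.inr_ne_inl (Sum.inl_injective h)

theorem cases_points {P : VDSpace F → Prop} (fn : ∀ f, P (fn f)) (nat : ∀ k, P (nat k))
    (pt : ∀ p, P (pt p)) : ∀ x, P x
  | Sum.inl (Sum.inl f) => fn f
  | Sum.inl (Sum.inr k) => nat k
  | Sum.inr p => pt p

@[simp] theorem basicNhd_pt (n : ℕ) (p : ↥F × ℕ × ℕ) : basicNhd n (pt p) = {pt p} := rfl

@[simp] theorem mem_basicNhd_fn {n : ℕ} {f : ↥F} {x : VDSpace F} :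
    x ∈ basicNhd n (fn f) ↔ x = fn f ∨ ∃ m, n ≤ m ∧ x = pt (f, m, (f : ℕ → ℕ) m) := by
  change x ∈ basicO f _ ↔ _
  simp only [basicO, Set.mem_union, Set.mem_singleton_iff, Set.mem_ofPred_eq, Finset.mem_image,
    Finset.mem_range, Prod.mk.injEq]
  grind

@[simp] theorem mem_basicNhd_nat {n k : ℕ} {x : VDSpace F} :
    x ∈ basicNhd n (nat k) ↔ x = nat k ∨ ∃ (g : ↥F) (l : ℕ), n ≤ l ∧ x = pt (g, k, l) :=
  Iff.rfl

theorem mem_basicNhd_self (n : ℕ) (x : VDSpace F) : x ∈ basicNhd n x := by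
  cases x using cases_points <;> simp

theorem isOpen_basicNhd (n : ℕ) (x : VDSpace F) : IsOpen (basicNhd n x) := by
  apply TopologicalSpace.isOpen_generateFrom_of_mem
  cases x using cases_points with
  | fn f => exact .inl (.inr ⟨f, _, rfl⟩)
  | nat k => exact .inr ⟨k, n, rfl⟩
  | pt p => exact .inl (.inl ⟨p, rfl⟩)

theorem basicNhd_antitone (x : VDSpace F) : Antitone fun n => basicNhd n x := by
  intro m n h y
  cases x using cases_points <;> simp <;> grind

theorem exists_basicNhd_subset {V : Set (VDSpace F)} (hV : IsOpen V) {x : VDSpace F}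
    (hx : x ∈ V) : ∃ n, basicNhd n x ⊆ V := by
  induction hV with
  | basic V h =>
    cases x using cases_points with
    | pt p => exact ⟨0, by simpa using hx⟩
    | fn f =>
      rcases h with (⟨p, rfl⟩ | ⟨g, s, rfl⟩) | ⟨k, n, rfl⟩
      · simp at hx
      · obtain rfl : f = g := by simpa [basicO] using hx
        refine ⟨s.sup Prod.fst + 1, fun y hy => ?_⟩
        obtain rfl | ⟨m, hm, rfl⟩ := mem_basicNhd_fn.1 hy
        · exact hx
        · refine .inr ⟨m, _, rfl, fun h => ?_, rfl⟩
          have := Finset.le_sup (f := Prod.fst) h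
          grind
      · simp [basicU] at hx
    | nat k =>
      rcases h with (⟨p, rfl⟩ | ⟨g, s, rfl⟩) | ⟨l, n, rfl⟩
      · simp at hx
      · simp [basicO] at hx
      · obtain rfl : k = l := by simpa [basicU] using hx
        exact ⟨n, subset_rfl⟩
  | univ => exact ⟨0, Set.subset_univ _⟩
  | inter V W _ _ ihV ihW =>
    obtain ⟨m, hm⟩ := ihV hx.1
    obtain ⟨n, hn⟩ := ihW hx.2
    exact ⟨max m n, Set.subset_inter
      ((basicNhd_antitone x (le_max_left m n)).trans hm)
      ((basicNhd_antitone x (le_max_right m n)).trans hn)⟩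
  | sUnion S _ ih =>
    obtain ⟨V, hV, hxV⟩ := hx
    obtain ⟨n, hn⟩ := ih V hV hxV
    exact ⟨n, hn.trans (Set.subset_sUnion_of_mem hV)⟩

/-- From some index on, a point lies in no basic neighborhood but its own. -/
theorem exists_forall_mem_basicNhd_eq (x : VDSpace F) :
    ∃ m, ∀ n ≥ m, ∀ y, x ∈ basicNhd n y → y = x := by
  cases x using cases_points with
  | fn f => exact ⟨0, fun n _ y => by cases y using cases_points <;> simp [eq_comm]⟩
  | nat k => exact ⟨0, fun n _ y => by cases y using cases_points <;> simp [eq_comm]⟩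
  | pt p =>
    obtain ⟨f, k, l⟩ := p
    refine ⟨max k l + 1, fun n hn y => ?_⟩
    cases y using cases_points <;> simp <;> grind

end VDSpace

/-- For every family `F ⊆ ℕ → ℕ`, the van Douwen space `X_F` is developable. -/
theorem vanDouwen_developable (F : Set (ℕ → ℕ)) :
    ∃ 𝒪 : ℕ → Set (Set (VDSpace F)), IsDevelopment 𝒪 := by
  refine ⟨fun n => Set.range (VDSpace.basicNhd n), ?_, ?_, ?_⟩
  · rintro n _ ⟨x, rfl⟩
    exact VDSpace.isOpen_basicNhd n x
  · exact fun n => Set.eq_univ_of_forall fun x => ⟨_, ⟨x, rfl⟩, VDSpace.mem_basicNhd_self n x⟩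
  · intro x C hC hx
    obtain ⟨m, hm⟩ := VDSpace.exists_forall_mem_basicNhd_eq x
    obtain ⟨n, hn⟩ := VDSpace.exists_basicNhd_subset hC.isOpen_compl hx
    refine ⟨max m n, ?_⟩
    rintro _ ⟨y, rfl⟩ hxy
    obtain rfl := hm _ (le_max_left m n) y hxy
    exact Set.disjoint_left.2 fun z hz => hn (VDSpace.basicNhd_antitone y (le_max_right m n) hz)
end

section
/- If F ⊆ ℕ → ℕ is bounded with respect to ≤*, then the van Douwen space X_F is collectionwise normal. -/
/-- `f ≤* g`: eventual domination, i.e. `f n ≤ g n` for all but finitely many `n`. -/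
def EvLE (f g : ℕ → ℕ) : Prop := ∀ᶠ n in Filter.atTop, f n ≤ g n

namespace VDSpace

variable {F : Set (ℕ → ℕ)}

theorem isOpen_singleton_pt (p : ↥F × ℕ × ℕ) : IsOpen ({pt p} : Set (VDSpace F)) :=
  TopologicalSpace.isOpen_generateFrom_of_mem (Or.inl (Or.inl ⟨p, rfl⟩))

theorem isOpen_basicO (f : ↥F) (s : Finset (ℕ × ℕ)) : IsOpen (basicO f s) :=
  TopologicalSpace.isOpen_generateFrom_of_mem (Or.inl (Or.inr ⟨f, s, rfl⟩))

theorem isOpen_basicU (k n : ℕ) : IsOpen (basicU k n : Set (VDSpace F)) :=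
  TopologicalSpace.isOpen_generateFrom_of_mem (Or.inr ⟨k, n, rfl⟩)

/-- A function eventually dominated by `g` exceeds `g` only on a finite part of its graph. -/
theorem exists_finset_le_of_evLE {f g : ℕ → ℕ} (h : EvLE f g) :
    ∃ s : Finset (ℕ × ℕ), ∀ m, (m, f m) ∉ s → f m ≤ g m := by
  obtain ⟨N, hN⟩ := Filter.eventually_atTop.1 h
  refine ⟨(Finset.range N).image fun m => (m, f m), fun m hm => hN m ?_⟩
  by_contra hlt
  exact hm (Finset.mem_image_of_mem _ (Finset.mem_range.2 (not_le.1 hlt)))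

/-- If `F` is bounded, the points of `X_F` have open neighborhoods such that any two
neighborhoods of distinct points can only share those points themselves. -/
theorem exists_isOpen_inter_subset_pair (hF : ∃ g : ℕ → ℕ, ∀ f ∈ F, EvLE f g) :
    ∃ B : VDSpace F → Set (VDSpace F), (∀ x, IsOpen (B x) ∧ x ∈ B x) ∧
      ∀ x y z, x ≠ y → z ∈ B x → z ∈ B y → z = x ∨ z = y := by
  obtain ⟨g, hg⟩ := hF
  choose s hs using fun f : ↥F => exists_finset_le_of_evLE (hg f f.2)
  let B : VDSpace F → Set (VDSpace F) :=
    Sum.elim (Sum.elim (fun f => basicO f (s f)) fun k => basicU k (g k + 1)) fun p => {pt p}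
  refine ⟨B, ?_, ?_⟩
  · rintro ((f | k) | p)
    · exact ⟨isOpen_basicO f (s f), Or.inl rfl⟩
    · exact ⟨isOpen_basicU k (g k + 1), Or.inl rfl⟩
    · exact ⟨isOpen_singleton_pt p, rfl⟩
  · have disj (f : ↥F) (k m n l : ℕ) (h : ↥F) (hmn : (f : ℕ → ℕ) m = n) (hns : (m, n) ∉ s f)
        (hl : g k + 1 ≤ l) (heq : (pt (f, m, n) : VDSpace F) = pt (h, k, l)) : False := by
      cases heq
      subst hmn
      have := hs f _ hns
      omega
    rintro ((f | k) | p) ((f' | k') | p') z hne hx hy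
    · rcases hx with hx | ⟨m, n, hmn, hns, rfl⟩
      · exact Or.inl hx
      rcases hy with hy | ⟨m', n', hmn', hns', heq⟩
      · exact Or.inr hy
      cases heq
      exact absurd rfl hne
    · rcases hx with hx | ⟨m, n, hmn, hns, rfl⟩
      · exact Or.inl hx
      rcases hy with hy | ⟨h, l, hl, heq⟩
      · exact Or.inr hy
      exact (disj f k' m n l h hmn hns hl heq).elim
    · exact Or.inr hy
    · rcases hx with hx | ⟨h, l, hl, rfl⟩
      · exact Or.inl hx
      rcases hy with hy | ⟨m, n, hmn, hns, heq⟩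
      · exact Or.inr hy
      exact (disj f' k m n l h hmn hns hl heq.symm).elim
    · rcases hx with hx | ⟨h, l, hl, rfl⟩
      · exact Or.inl hx
      rcases hy with hy | ⟨h', l', hl', heq⟩
      · exact Or.inr hy
      cases heq
      exact absurd rfl hne
    · exact Or.inr hy
    all_goals exact Or.inl hx

end VDSpace

/-- If `F ⊆ ℕ → ℕ` is bounded with respect to `≤*`, then the van Douwen space `X_F` is
collectionwise normal: every discrete family `𝒞` of pairwise disjoint closed sets can be
separated by a family of pairwise disjoint open sets `(U_C)_{C ∈ 𝒞}` with `C ⊆ U_C`. -/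
theorem vanDouwen_collectionwiseNormal (F : Set (ℕ → ℕ))
    (hF : ∃ g : ℕ → ℕ, ∀ f ∈ F, EvLE f g) :
    ∀ 𝒞 : Set (Set (VDSpace F)),
      (∀ C ∈ 𝒞, IsClosed C) →
      𝒞.Pairwise Disjoint →
      (∀ x : VDSpace F, ∃ V ∈ nhds x, {C ∈ 𝒞 | (V ∩ C).Nonempty}.Subsingleton) →
      ∃ U : 𝒞 → Set (VDSpace F),
        (∀ C : 𝒞, IsOpen (U C) ∧ (C : Set (VDSpace F)) ⊆ U C) ∧
        ∀ C C' : 𝒞, C ≠ C' → Disjoint (U C) (U C') := by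
  intro 𝒞 _ _ hdisc
  obtain ⟨B, hB, hBinter⟩ := VDSpace.exists_isOpen_inter_subset_pair hF
  choose V hV hVsub using hdisc
  refine ⟨fun C => ⋃ x ∈ (C : Set (VDSpace F)), B x ∩ interior (V x), fun C => ⟨?_, ?_⟩, ?_⟩
  · exact isOpen_biUnion fun x _ => (hB x).1.inter isOpen_interior
  · exact fun x hx => Set.mem_biUnion hx ⟨(hB x).2, mem_interior_iff_mem_nhds.2 (hV x)⟩
  · intro C C' hne
    refine Set.disjoint_left.2 fun z hz hz' => hne (Subtype.ext ?_)
    simp only [Set.mem_iUnion, exists_prop] at hz hz'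
    obtain ⟨x, hxC, hzx, hzVx⟩ := hz
    obtain ⟨y, hyC, hzy, hzVy⟩ := hz'
    have hxV := mem_of_mem_nhds (hV x)
    have hyV := mem_of_mem_nhds (hV y)
    have meets {D : 𝒞} {w u : VDSpace F} (hw : w ∈ V u) (hD : w ∈ (D : Set (VDSpace F))) :
        (D : Set (VDSpace F)) ∈ {C ∈ 𝒞 | (V u ∩ C).Nonempty} := ⟨D.2, w, hw, hD⟩
    by_cases hxy : x = y
    · subst hxy
      exact hVsub x (meets hxV hxC) (meets hxV hyC)
    · rcases hBinter x y z hxy hzx hzy with rfl | rfl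
      · exact hVsub y (meets (interior_subset hzVy) hxC) (meets hyV hyC)
      · exact hVsub x (meets hxV hxC) (meets (interior_subset hzVx) hyC)
end

section
/- Let 𝔟 denote the bounding number, i.e., the least cardinality of a family F ⊆ ℕ → ℕ that is unbounded with respect to ≤*. There exists a topological space X of cardinality 𝔟 that is regular Hausdorff and developable (hence a first countable Moore space), is not collectionwise Hausdorff and not metrizable, and all of whose subspaces of cardinality strictly less than 𝔟 are metrizable. -/
/-- The bounding number `𝔟`: the least cardinality of a family `F ⊆ ℕ → ℕ` that is
unbounded with respect to `≤*`. -/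
noncomputable def boundingNumber : Cardinal :=
  sInf {c : Cardinal | ∃ F : Set (ℕ → ℕ), (¬ ∃ g : ℕ → ℕ, ∀ f ∈ F, EvLE f g) ∧
    Cardinal.mk F = c}

/-- A topological space `X` is collectionwise Hausdorff if for every closed discrete `D ⊆ X`
there is a family of pairwise disjoint open sets, one around each point of `D`. -/
def CollectionwiseHausdorff (X : Type*) [TopologicalSpace X] : Prop :=
  ∀ D : Set X, IsClosed D → (∀ d ∈ D, ∃ V : Set X, IsOpen V ∧ V ∩ D = {d}) →
    ∃ U : D → Set X, (∀ d : D, IsOpen (U d) ∧ (d : X) ∈ U d) ∧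
      ∀ d d' : D, d ≠ d' → Disjoint (U d) (U d')

open Topology Filter Cardinal

/-- A T0 space is metrizable as soon as countably many locally constant maps determine its
neighbourhoods. -/
theorem metrizableSpace_of_locally_constant {Y Z : Type*} [TopologicalSpace Y] [T0Space Y]
    (φ : ℕ → Y → Z) (hφ : ∀ k y, ∀ᶠ x in 𝓝 y, φ k x = φ k y)
    (hsep : ∀ y, ∀ U ∈ 𝓝 y, ∃ k, ∀ x, φ k x = φ k y → x ∈ U) :
    TopologicalSpace.MetrizableSpace Y := by
  let _ : TopologicalSpace Z := ⊥
  have : DiscreteTopology Z := ⟨rfl⟩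
  have hind : IsInducing (fun y k => φ k y : Y → ℕ → Z) := by
    rw [isInducing_iff_nhds]
    intro y
    apply le_antisymm
    · rw [← tendsto_iff_comap, tendsto_pi_nhds]
      intro k
      exact tendsto_nhds_of_eventually_eq (hφ k y)
    · intro U hU
      obtain ⟨k, hk⟩ := hsep y U hU
      refine ⟨{z | z k = φ k y}, ?_, fun x hx => hk x hx⟩
      exact ((isOpen_discrete {φ k y}).preimage
        (continuous_apply (A := fun _ : ℕ => Z) k)).mem_nhds rfl
  exact hind.isEmbedding.metrizableSpace

theorem collectionwiseHausdorff_of_metrizableSpace (X : Type*) [TopologicalSpace X]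
    [TopologicalSpace.MetrizableSpace X] : CollectionwiseHausdorff X := by
  let := TopologicalSpace.metrizableSpaceMetric X
  intro D _ hD
  have h : ∀ d : D, ∃ ε > 0, Metric.ball (d : X) ε ∩ D ⊆ {(d : X)} := by
    intro d
    obtain ⟨V, hV, hVD⟩ := hD d d.2
    have hd : (d : X) ∈ V ∩ D := hVD ▸ rfl
    obtain ⟨ε, hε, hball⟩ := Metric.isOpen_iff.1 hV d hd.1
    exact ⟨ε, hε, hVD ▸ Set.inter_subset_inter_left D hball⟩
  choose ε hε hball using h
  refine ⟨fun d => Metric.ball d (ε d / 2),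
    fun d => ⟨Metric.isOpen_ball, Metric.mem_ball_self (half_pos (hε d))⟩, ?_⟩
  intro d d' hne
  rw [Set.disjoint_left]
  intro x hx hx'
  rw [Metric.mem_ball] at hx hx'
  have htri := dist_triangle_left (d : X) d' x
  rcases le_total (ε d) (ε d') with hle | hle
  · exact hne (Subtype.ext (hball d' ⟨Metric.mem_ball.2 (by linarith), d.2⟩))
  · exact hne (Subtype.ext (hball d ⟨Metric.mem_ball.2 (by rw [dist_comm]; linarith), d'.2⟩).symm)

theorem exists_unbounded_of_card_eq_boundingNumber :
    ∃ F : Set (ℕ → ℕ), (¬ ∃ g : ℕ → ℕ, ∀ f ∈ F, EvLE f g) ∧ #F = boundingNumber := by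
  refine csInf_mem (s := {c : Cardinal | ∃ F : Set (ℕ → ℕ),
    (¬ ∃ g : ℕ → ℕ, ∀ f ∈ F, EvLE f g) ∧ #F = c}) ⟨_, Set.univ, ?_, rfl⟩
  rintro ⟨g, hg⟩
  obtain ⟨n, hn⟩ := (hg (fun n => g n + 1) trivial).exists
  simp at hn

theorem exists_bound_of_card_lt_boundingNumber {F : Set (ℕ → ℕ)} (hF : #F < boundingNumber) :
    ∃ g : ℕ → ℕ, ∀ f ∈ F, EvLE f g := by
  by_contra h
  exact notMem_of_lt_csInf' hF ⟨F, h, rfl⟩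

theorem aleph0_le_boundingNumber : ℵ₀ ≤ boundingNumber := by
  obtain ⟨F, hF, hcard⟩ := exists_unbounded_of_card_eq_boundingNumber
  rw [← hcard, Cardinal.aleph0_le_mk_iff, Set.infinite_coe_iff]
  intro hfin
  refine hF ⟨fun n => hfin.toFinset.sup (fun f => f n), fun f hf => Eventually.of_forall fun n => ?_⟩
  exact Finset.le_sup (f := fun f : ℕ → ℕ => f n) (hfin.mem_toFinset.2 hf)

/-- The points of the space attached to a family `F` of functions: isolated cells `(f, n)`, a
limit point for each row `f`, and a limit point for each column `n`. -/
inductive GridSpace (F : Set (ℕ → ℕ)) : Type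
  | column (n : ℕ) : GridSpace F
  | row (f : F) : GridSpace F
  | cell (f : F) (n : ℕ) : GridSpace F

namespace GridSpace

variable {F : Set (ℕ → ℕ)}

/-- The basic neighbourhoods: the cells of row `f` converge to `row f`, and the cells `(f, n)`
converge to `column n` as `f n` grows. -/
def basicNhd : GridSpace F → ℕ → Set (GridSpace F)
  | column n, k => {x | x = column n ∨ ∃ f : F, k ≤ f.1 n ∧ x = cell f n}
  | row f, k => {x | x = row f ∨ ∃ n, k ≤ n ∧ x = cell f n}
  | cell f n, _ => {cell f n}

theorem mem_basicNhd_self (x : GridSpace F) (k : ℕ) : x ∈ basicNhd x k := by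
  cases x <;> simp [basicNhd]

theorem basicNhd_antitone (x : GridSpace F) : Antitone (basicNhd x) := by
  intro j k hjk y hy
  cases x with
  | cell f n => exact hy
  | column n =>
    rcases hy with rfl | ⟨f, hf, rfl⟩
    exacts [Or.inl rfl, Or.inr ⟨f, hjk.trans hf, rfl⟩]
  | row f =>
    rcases hy with rfl | ⟨n, hn, rfl⟩
    exacts [Or.inl rfl, Or.inr ⟨n, hjk.trans hn, rfl⟩]

instance : TopologicalSpace (GridSpace F) where
  IsOpen U := ∀ x ∈ U, ∃ k, basicNhd x k ⊆ U
  isOpen_univ _ _ := ⟨0, Set.subset_univ _⟩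
  isOpen_inter U V hU hV x hx := by
    obtain ⟨j, hj⟩ := hU x hx.1
    obtain ⟨k, hk⟩ := hV x hx.2
    exact ⟨max j k, Set.subset_inter
      ((basicNhd_antitone x (le_max_left j k)).trans hj)
      ((basicNhd_antitone x (le_max_right j k)).trans hk)⟩
  isOpen_sUnion S hS x hx := by
    obtain ⟨U, hU, hxU⟩ := hx
    obtain ⟨k, hk⟩ := hS U hU x hxU
    exact ⟨k, hk.trans (Set.subset_sUnion_of_mem hU)⟩

theorem isOpen_iff_basicNhd {U : Set (GridSpace F)} :
    IsOpen U ↔ ∀ x ∈ U, ∃ k, basicNhd x k ⊆ U := Iff.rfl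

theorem isOpen_basicNhd (x : GridSpace F) (k : ℕ) : IsOpen (basicNhd x k) := by
  rw [isOpen_iff_basicNhd]
  intro y hy
  cases x with
  | cell f n =>
    obtain rfl : y = cell f n := hy
    exact ⟨k, subset_rfl⟩
  | column n =>
    rcases hy with rfl | ⟨f, hf, rfl⟩
    exacts [⟨k, subset_rfl⟩, ⟨0, Set.singleton_subset_iff.2 (Or.inr ⟨f, hf, rfl⟩)⟩]
  | row f =>
    rcases hy with rfl | ⟨n, hn, rfl⟩
    exacts [⟨k, subset_rfl⟩, ⟨0, Set.singleton_subset_iff.2 (Or.inr ⟨n, hn, rfl⟩)⟩]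

theorem nhds_hasBasis_basicNhd (x : GridSpace F) :
    (𝓝 x).HasBasis (fun _ => True) (basicNhd x) := by
  refine ⟨fun U => ⟨fun hU => ?_, fun ⟨k, _, hk⟩ =>
    mem_of_superset ((isOpen_basicNhd x k).mem_nhds (mem_basicNhd_self x k)) hk⟩⟩
  obtain ⟨V, hVU, hV, hx⟩ := mem_nhds_iff.1 hU
  obtain ⟨k, hk⟩ := hV x hx
  exact ⟨k, trivial, hk.trans hVU⟩

theorem exists_forall_mem_basicNhd_eq (x : GridSpace F) :
    ∃ k, ∀ y, x ∈ basicNhd y k → y = x := by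
  cases x with
  | cell f n =>
    refine ⟨max n (f.1 n) + 1, fun y hy => ?_⟩
    cases y with
    | cell f' n' => exact hy.symm
    | column n' =>
      rcases hy with hy | ⟨f', hf', hy⟩
      · cases hy
      · cases hy; omega
    | row f' =>
      rcases hy with hy | ⟨n', hn', hy⟩
      · cases hy
      · cases hy; omega
  | column n =>
    refine ⟨0, fun y hy => ?_⟩
    cases y <;> simp_all [basicNhd]
  | row f =>
    refine ⟨0, fun y hy => ?_⟩
    cases y <;> simp_all [basicNhd]

theorem isClosed_basicNhd (x : GridSpace F) (k : ℕ) : IsClosed (basicNhd x k) := by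
  rw [← isOpen_compl_iff, isOpen_iff_basicNhd]
  intro y hy
  cases y with
  | cell f n => exact ⟨0, Set.singleton_subset_iff.2 hy⟩
  | column n =>
    cases x with
    | cell f m =>
      refine ⟨f.1 n + 1, ?_⟩
      rintro z (rfl | ⟨f', hf', rfl⟩) hz
      · exact hy hz
      · cases hz; omega
    | column m =>
      refine ⟨0, ?_⟩
      rintro z (rfl | ⟨f', hf', rfl⟩) hz
      · exact hy hz
      · rcases hz with hz | ⟨f, hf, hz⟩ <;> cases hz
        exact hy (Or.inl rfl)
    | row f =>
      refine ⟨f.1 n + 1, ?_⟩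
      rintro z (rfl | ⟨f', hf', rfl⟩) hz
      · exact hy hz
      · rcases hz with hz | ⟨m, hm, hz⟩ <;> cases hz
        omega
  | row f =>
    cases x with
    | cell f' m =>
      refine ⟨m + 1, ?_⟩
      rintro z (rfl | ⟨n, hn, rfl⟩) hz
      · exact hy hz
      · cases hz; omega
    | column m =>
      refine ⟨m + 1, ?_⟩
      rintro z (rfl | ⟨n, hn, rfl⟩) hz
      · exact hy hz
      · rcases hz with hz | ⟨f', hf', hz⟩ <;> cases hz
        omega
    | row f' =>
      refine ⟨0, ?_⟩
      rintro z (rfl | ⟨n, hn, rfl⟩) hz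
      · exact hy hz
      · rcases hz with hz | ⟨m, hm, hz⟩ <;> cases hz
        exact hy (Or.inl rfl)

instance : RegularSpace (GridSpace F) :=
  .of_hasBasis nhds_hasBasis_basicNhd fun x k _ => isClosed_basicNhd x k

instance : T2Space (GridSpace F) := by
  refine ⟨fun x y hxy => ?_⟩
  obtain ⟨k, hk⟩ := exists_forall_mem_basicNhd_eq y
  exact ⟨basicNhd x k, (basicNhd x k)ᶜ, isOpen_basicNhd x k, (isClosed_basicNhd x k).isOpen_compl,
    mem_basicNhd_self x k, fun h => hxy (hk x h), disjoint_compl_right⟩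

instance : FirstCountableTopology (GridSpace F) :=
  ⟨fun x => (nhds_hasBasis_basicNhd x).isCountablyGenerated⟩

theorem isDevelopment_range_basicNhd :
    IsDevelopment (fun k => Set.range fun x : GridSpace F => basicNhd x k) := by
  refine ⟨?_, ?_, ?_⟩
  · rintro k _ ⟨x, rfl⟩
    exact isOpen_basicNhd x k
  · exact fun k => Set.eq_univ_of_forall fun x => ⟨_, ⟨x, rfl⟩, mem_basicNhd_self x k⟩
  · intro x C hC hx
    obtain ⟨j, hj⟩ := isOpen_iff_basicNhd.1 hC.isOpen_compl x hx
    obtain ⟨k, hk⟩ := exists_forall_mem_basicNhd_eq x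
    refine ⟨max j k, ?_⟩
    rintro _ ⟨y, rfl⟩ hxy
    obtain rfl := hk y (basicNhd_antitone y (le_max_right j k) hxy)
    exact Set.disjoint_left.2 fun z hz => hj (basicNhd_antitone y (le_max_left j k) hz)

theorem not_collectionwiseHausdorff (hF : ¬ ∃ g : ℕ → ℕ, ∀ f ∈ F, EvLE f g) :
    ¬ CollectionwiseHausdorff (GridSpace F) := by
  intro h
  let D : Set (GridSpace F) := {x | ∀ f n, x ≠ cell f n}
  have hD : IsClosed D := by
    rw [← isOpen_compl_iff, isOpen_iff_basicNhd]
    intro x hx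
    cases x with
    | cell f n => exact ⟨0, Set.singleton_subset_iff.2 hx⟩
    | column n => exact absurd (fun f m => by simp) hx
    | row f => exact absurd (fun f m => by simp) hx
  obtain ⟨U, hU, hdisj⟩ := h D hD fun d hd => ⟨basicNhd d 0, isOpen_basicNhd d 0, by
    refine Set.Subset.antisymm ?_ (Set.singleton_subset_iff.2 ⟨mem_basicNhd_self d 0, hd⟩)
    rintro x ⟨hxd, hx⟩
    cases d with
    | cell f n => exact hxd
    | column n =>
      rcases hxd with hxd | ⟨f, -, rfl⟩
      exacts [hxd, absurd rfl (hx f n)]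
    | row f =>
      rcases hxd with hxd | ⟨n, -, rfl⟩
      exacts [hxd, absurd rfl (hx f n)]⟩
  let c : ℕ → D := fun n => ⟨column n, fun f m => by simp⟩
  let r : F → D := fun f => ⟨row f, fun f m => by simp⟩
  have hc : ∀ n, ∃ k, basicNhd (column n) k ⊆ U (c n) := fun n => (hU (c n)).1 _ (hU (c n)).2
  choose g hg using hc
  refine hF ⟨g, fun f hf => ?_⟩
  obtain ⟨k, hk⟩ := isOpen_iff_basicNhd.1 (hU (r ⟨f, hf⟩)).1 _ (hU (r ⟨f, hf⟩)).2
  filter_upwards [eventually_ge_atTop k] with n hn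
  by_contra! hlt
  have hne : c n ≠ r ⟨f, hf⟩ := by simp [c, r]
  exact Set.disjoint_left.1 (hdisj _ _ hne) (hg n (Or.inr ⟨⟨f, hf⟩, hlt.le, rfl⟩))
    (hk (Or.inr ⟨n, hn, rfl⟩))

/-- The functions whose row meets `Y`. -/
def support (Y : Set (GridSpace F)) : Set (ℕ → ℕ) :=
  {f | ∃ hf : f ∈ F, row ⟨f, hf⟩ ∈ Y ∨ ∃ n, cell ⟨f, hf⟩ n ∈ Y}

theorem mk_support_le (Y : Set (GridSpace F)) : #(support Y) ≤ #Y := by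
  have h : ∀ f : support Y, ∃ y : Y, y.1 = row ⟨f, f.2.1⟩ ∨ ∃ n, y.1 = cell ⟨f, f.2.1⟩ n := by
    rintro ⟨f, hf, hY | ⟨n, hY⟩⟩
    exacts [⟨⟨_, hY⟩, Or.inl rfl⟩, ⟨⟨_, hY⟩, Or.inr ⟨n, rfl⟩⟩]
  choose y hy using h
  refine Cardinal.mk_le_of_injective (f := y) fun f f' hff' => ?_
  have h1 := hy f
  have h2 := hy f'
  rw [hff'] at h1
  apply Subtype.ext
  rcases h1 with h1 | ⟨n, h1⟩ <;> rcases h2 with h2 | ⟨m, h2⟩ <;> simp_all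

open Classical in
/-- The limit point to which a cell is assigned when `g` bounds `f` from `h f` on; a point
assigned to no other is its own center. -/
noncomputable def center (g : ℕ → ℕ) (h : (ℕ → ℕ) → ℕ) : GridSpace F → GridSpace F
  | cell f n => if h f ≤ n then row f else if g n < f.1 n then column n else cell f n
  | x => x

theorem metrizableSpace_of_support_bounded {Y : Set (GridSpace F)} {g : ℕ → ℕ}
    (hg : ∀ f ∈ support Y, EvLE f g) : TopologicalSpace.MetrizableSpace Y := by
  classical
  have hg' : ∀ f : ℕ → ℕ, ∃ m, f ∈ support Y → ∀ n, m ≤ n → f n ≤ g n := by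
    intro f
    by_cases hf : f ∈ support Y
    · obtain ⟨m, hm⟩ := eventually_atTop.1 (hg f hf)
      exact ⟨m, fun _ => hm⟩
    · exact ⟨0, fun h => absurd h hf⟩
  choose h hh using hg'
  let c : GridSpace F → GridSpace F := center g h
  have hloc : ∀ y, (∃ j, basicNhd y j ⊆ {y}) ∨
      c y = y ∧ ∃ j, ∀ x ∈ basicNhd y j, x ∈ Y → c x = y := by
    intro y
    cases y with
    | cell f n => exact Or.inl ⟨0, subset_rfl⟩
    | column n =>
      refine Or.inr ⟨rfl, g n + 1, ?_⟩
      rintro x (rfl | ⟨f, hf, rfl⟩) hx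
      · rfl
      · have hn : ¬ h f ≤ n := fun hn => by
          have := hh f ⟨f.2, Or.inr ⟨n, hx⟩⟩ n hn
          omega
        have hf' : g n < f.1 n := hf
        simp [c, center, hn, hf']
    | row f =>
      refine Or.inr ⟨rfl, h f, ?_⟩
      rintro x (rfl | ⟨n, hn, rfl⟩) hx
      · rfl
      · simp [c, center, hn]
  refine metrizableSpace_of_locally_constant
    (fun k (y : Y) => if y.1 ∈ basicNhd (c y) k then c y else y.1) ?_ ?_
  · intro k y
    rw [nhds_subtype_eq_comap, eventually_comap]
    rcases hloc y with ⟨j, hj⟩ | ⟨hy, j, hj⟩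
    · filter_upwards [(nhds_hasBasis_basicNhd y.1).mem_of_mem (i := j) trivial]
      rintro _ hx x rfl
      rw [Subtype.ext (hj hx)]
    · filter_upwards [(nhds_hasBasis_basicNhd y.1).mem_of_mem (i := max j k) trivial]
      rintro _ hx x rfl
      have hcx := hj _ (basicNhd_antitone _ (le_max_left j k) hx) x.2
      simp [hcx, hy, mem_basicNhd_self, basicNhd_antitone _ (le_max_right j k) hx]
  · intro y U hU
    rw [nhds_subtype_eq_comap] at hU
    obtain ⟨j, -, hj⟩ := ((nhds_hasBasis_basicNhd y.1).comap _).mem_iff.1 hU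
    obtain ⟨k, hk⟩ := exists_forall_mem_basicNhd_eq y.1
    refine ⟨max j k, fun x hx => hj ?_⟩
    have hy : (if y.1 ∈ basicNhd (c y) (max j k) then c y else y.1) = y.1 := by
      split_ifs with hmem
      · exact hk _ (basicNhd_antitone _ (le_max_right j k) hmem)
      · rfl
    simp only [hy] at hx
    split_ifs at hx with hmem
    · rw [hx] at hmem
      exact basicNhd_antitone _ (le_max_left j k) hmem
    · exact hx ▸ mem_basicNhd_self x.1 j

/-- A grid space consists of its columns, its rows and its cells. -/
def equivSum : GridSpace F ≃ ℕ ⊕ (F ⊕ F × ℕ) where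
  toFun
    | column n => .inl n
    | row f => .inr (.inl f)
    | cell f n => .inr (.inr (f, n))
  invFun
    | .inl n => column n
    | .inr (.inl f) => row f
    | .inr (.inr (f, n)) => cell f n
  left_inv x := by cases x <;> rfl
  right_inv x := by rcases x with n | f | ⟨f, n⟩ <;> rfl

theorem mk_eq (hF : ℵ₀ ≤ #F) : #(GridSpace F) = #F := by
  rw [Cardinal.mk_congr equivSum]
  simp [Cardinal.mul_aleph0_eq hF, Cardinal.add_eq_self hF, Cardinal.add_eq_right hF hF]

end GridSpace

/-- There is a topological space of cardinality `𝔟` which is a (first countable) Moore space,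
is not collectionwise Hausdorff and not metrizable, but all of whose subspaces of cardinality
`< 𝔟` are metrizable. -/
theorem exists_moore_space_of_size_bounding_number :
    ∃ (X : Type) (_ : TopologicalSpace X),
      Cardinal.mk X = boundingNumber ∧
      RegularSpace X ∧ T2Space X ∧
      (∃ 𝒪 : ℕ → Set (Set X), IsDevelopment 𝒪) ∧
      FirstCountableTopology X ∧
      ¬ CollectionwiseHausdorff X ∧
      ¬ TopologicalSpace.MetrizableSpace X ∧
      ∀ Y : Set X, Cardinal.mk Y < boundingNumber →
        TopologicalSpace.MetrizableSpace Y := by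
  obtain ⟨F, hF, hcard⟩ := exists_unbounded_of_card_eq_boundingNumber
  have hnot := GridSpace.not_collectionwiseHausdorff hF
  refine ⟨GridSpace F, inferInstance, ?_, inferInstance, inferInstance,
    ⟨_, GridSpace.isDevelopment_range_basicNhd⟩, inferInstance, hnot,
    fun _ => hnot (collectionwiseHausdorff_of_metrizableSpace _), fun Y hY => ?_⟩
  · rw [GridSpace.mk_eq (hcard ▸ aleph0_le_boundingNumber), hcard]
  · obtain ⟨g, hg⟩ := exists_bound_of_card_lt_boundingNumber
      ((GridSpace.mk_support_le Y).trans_lt hY)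
    exact GridSpace.metrizableSpace_of_support_bounded hg
end

section
/- The following two reflection statements are equivalent: (i) for every first countable topological space X, if X is not metrizable then there is a subset Y ⊆ X of cardinality at most ℵ₁ such that Y with the subspace topology is not metrizable; (ii) for every topological space X in which every point has a neighborhood basis of cardinality at most ℵ₁ (i.e., χ(x, X) < ℵ₂ for all x ∈ X), if X is not metrizable then there is a subset Y ⊆ X of cardinality at most ℵ₁ such that Y with the subspace topology is not metrizable. -/
universe u

open Cardinal Set in
/-- The countable subsets of a set of cardinality at most `ℵ₁` have a cofinal family of
cardinality at most `ℵ₁`. -/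
theorem exists_cofinal_family_countable_of_mk_le_aleph_one {α : Type u} (hα : #α ≤ ℵ₁) :
    ∃ (ι : Type u) (C : ι → Set α), #ι ≤ ℵ₁ ∧ (∀ t, (C t).Countable) ∧
      ∀ b : ℕ → α, ∃ t, ∀ n, b n ∈ C t := by
  have hι : #(ℵ₁ : Cardinal.{u}).ord.ToType = ℵ₁ := by simp
  obtain ⟨f⟩ : Nonempty (α ↪ (ℵ₁ : Cardinal.{u}).ord.ToType) := by
    rwa [← Cardinal.le_def, hι]
  refine ⟨_, fun t ↦ f ⁻¹' Iio t, hι.le, fun t ↦ ?_, fun b ↦ ?_⟩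
  · refine Countable.preimage_of_injOn ?_ f.injective.injOn
    rw [← Cardinal.le_aleph0_iff_set_countable, ← Order.lt_succ_iff, Cardinal.succ_aleph0]
    exact (Cardinal.mk_Iio_lt t (by simp)).trans_eq hι
  · have hb : ¬ IsCofinal (range fun n ↦ f (b n)) := by
      intro h
      have hle := Order.cof_le h
      rw [Ordinal.cof_toType, Cardinal.isRegular_aleph_one.cof_ord] at hle
      exact absurd (hle.trans (Cardinal.le_aleph0_iff_set_countable.2 (countable_range _)))
        (not_le.2 Cardinal.aleph0_lt_aleph_one)
    simpa [IsCofinal] using hb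

open Cardinal Set Filter in
/-- If `x` has a neighborhood basis of cardinality at most `ℵ₁` and every subspace of cardinality
at most `ℵ₁` is first countable, then `x` has a countable neighborhood basis. -/
theorem isCountablyGenerated_nhds_of_forall_mk_le_aleph_one {X : Type u} [TopologicalSpace X]
    {x : X} {B : Set (Set X)} (hB : #B ≤ ℵ₁) (hx : (nhds x).HasBasis (fun s ↦ s ∈ B) id)
    (h : ∀ Y : Set X, #Y ≤ ℵ₁ → FirstCountableTopology Y) :
    (nhds x).IsCountablyGenerated := by
  obtain ⟨ι, C, hι, hC, hCb⟩ := exists_cofinal_family_countable_of_mk_le_aleph_one hB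
  by_contra hgen
  have key (t : ι) : ∃ γ ∈ B, ∀ s ∈ C t, ¬ s.1 ⊆ γ := by
    by_contra! hcon
    have hbasis : (nhds x).HasCountableBasis (fun s : B ↦ s ∈ C t) Subtype.val := by
      refine ⟨⟨fun u ↦ ⟨fun hu ↦ ?_, ?_⟩⟩, hC t⟩
      · obtain ⟨γ, hγ, hγu⟩ := hx.mem_iff.1 hu
        obtain ⟨s, hs, hsγ⟩ := hcon γ hγ
        exact ⟨s, hs, hsγ.trans hγu⟩
      · rintro ⟨s, -, hsu⟩
        exact mem_of_superset (hx.mem_of_mem s.2) hsu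
    exact hgen hbasis.isCountablyGenerated
  choose γ hγB hγ using key
  have hpt (p : ι × B) : ∃ y, p.2 ∈ C p.1 → y ∈ p.2.1 ∧ y ∉ γ p.1 := by
    by_cases hp : p.2 ∈ C p.1
    · obtain ⟨y, hy⟩ := not_subset.1 (hγ _ _ hp)
      exact ⟨y, fun _ ↦ hy⟩
    · exact ⟨x, fun h' ↦ absurd h' hp⟩
  choose y hy using hpt
  have hY : #(insert x (range y) : Set X) ≤ ℵ₁ := by
    have h₀ : ℵ₀ ≤ (ℵ₁ : Cardinal.{u}) := Cardinal.aleph0_lt_aleph_one.le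
    refine (mk_insert_le).trans (add_le_of_le h₀ ?_ (one_le_aleph0.trans h₀))
    refine mk_range_le.trans ?_
    rw [mk_prod, lift_id, lift_id]
    exact mul_le_of_le h₀ hι hB
  have := h _ hY
  have hb := hx.comap (Subtype.val : (insert x (range y) : Set X) → X)
  rw [← nhds_subtype_eq_comap (x := x) (h := mem_insert x _)] at hb
  obtain ⟨b, hbB, hbasis⟩ := hb.exists_antitone_subbasis
  obtain ⟨t, ht⟩ := hCb fun n ↦ ⟨b n, hbB n⟩
  obtain ⟨n, -, hn⟩ := hbasis.1.mem_iff.1 (hb.mem_of_mem (hγB t))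
  have hyn := hy (t, ⟨b n, hbB n⟩) (ht n)
  exact hyn.2 (@hn ⟨_, mem_insert_of_mem _ (mem_range_self _)⟩ hyn.1)

open Cardinal in
/-- The original Hamburger problem (reflection of non-metrizability for first countable
spaces down to cardinality `≤ ℵ₁`) is equivalent to the principle `HH(< ℵ₂)` (the same
reflection for spaces all of whose points have character `< ℵ₂`, i.e. admit a neighborhood
basis of cardinality at most `ℵ₁`). -/
theorem hamburger_iff_HH_aleph2 :
    (∀ (X : Type u) (_ : TopologicalSpace X), FirstCountableTopology X →
        ¬ TopologicalSpace.MetrizableSpace X →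
        ∃ Y : Set X, #Y ≤ aleph 1 ∧ ¬ TopologicalSpace.MetrizableSpace Y) ↔
    (∀ (X : Type u) (_ : TopologicalSpace X),
        (∀ x : X, ∃ B : Set (Set X), #B ≤ aleph 1 ∧
          (nhds x).HasBasis (fun s : Set X => s ∈ B) id) →
        ¬ TopologicalSpace.MetrizableSpace X →
        ∃ Y : Set X, #Y ≤ aleph 1 ∧ ¬ TopologicalSpace.MetrizableSpace Y) := by
  refine ⟨fun H X _ hX hmet ↦ ?_, fun H X _ _ hmet ↦ H X _ (fun x ↦ ?_) hmet⟩
  · by_contra! hcon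
    obtain ⟨Y, hY, hYmet⟩ := H X _ ⟨fun x ↦ by
      obtain ⟨B, hB, hx⟩ := hX x
      refine isCountablyGenerated_nhds_of_forall_mk_le_aleph_one hB hx fun Y hY ↦ ?_
      have := hcon Y hY
      let := TopologicalSpace.metrizableSpaceMetric Y
      infer_instance⟩ hmet
    exact hYmet (hcon Y hY)
  · obtain ⟨b, hb⟩ := (nhds x).exists_antitone_basis
    refine ⟨Set.range b, ?_, ⟨fun t ↦ ?_⟩⟩
    · exact (Cardinal.le_aleph0_iff_set_countable.2 (Set.countable_range b)).trans
        Cardinal.aleph0_lt_aleph_one.le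
    · simp [hb.1.mem_iff]
end

section
/- Let κ be a regular cardinal with κ ≥ ℵ₂, let ν and μ be two distinct infinite regular cardinals with ν < κ and μ < κ, and let X be a set of ordinals containing every ordinal less than κ⁺ (the cardinal successor of κ). Then for every function f from the finite subsets of X to X there exists a set x ⊆ X such that: the cardinality of x is less than κ; x is closed under f (i.e., f(e) ∈ x for every finite e ⊆ x); there is an ordinal β < κ of cofinality ν such that {α ∈ x : α < κ} is exactly the set of ordinals less than β; and the supremum of {α ∈ x : α < κ⁺} has cofinality μ. (This says that the set S = {x ∈ 𝒫_κ(X) : x ∩ κ ∈ E^κ_ν and cf(sup(x ∩ κ⁺)) = μ} is stationary in 𝒫_κ(X).) -/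
open Cardinal

/-- The `n`-th stage in the generation of the closure of `A` under `f`. -/
def finClosureStage {T : Type*} (f : Finset T → T) (A : Set T) : ℕ → Set T
  | 0 => A
  | n + 1 => finClosureStage f A n ∪ f '' {e | ↑e ⊆ finClosureStage f A n}

/-- The smallest set that contains `A` and is closed under `f : Finset T → T`. -/
def finClosure {T : Type*} (f : Finset T → T) (A : Set T) : Set T :=
  ⋃ n, finClosureStage f A n

section finClosure

variable {T : Type*} {f : Finset T → T} {A B : Set T}

theorem subset_finClosure : A ⊆ finClosure f A :=
  Set.subset_iUnion (finClosureStage f A) 0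

theorem finClosureStage_monotone : Monotone (finClosureStage f A) :=
  monotone_nat_of_le_succ fun _ => Set.subset_union_left

theorem apply_mem_finClosure {e : Finset T} (he : ↑e ⊆ finClosure f A) :
    f e ∈ finClosure f A := by
  obtain ⟨n, hn⟩ :=
    finClosureStage_monotone.directed_le.exists_mem_subset_of_finset_subset_biUnion he
  exact Set.mem_iUnion.2 ⟨n + 1, Or.inr ⟨e, hn, rfl⟩⟩

theorem finClosure_subset (hAB : A ⊆ B) (hB : ∀ e : Finset T, ↑e ⊆ B → f e ∈ B) :
    finClosure f A ⊆ B := by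
  refine Set.iUnion_subset fun n => ?_
  induction n with
  | zero => exact hAB
  | succ n ih =>
    refine Set.union_subset ih ?_
    rintro _ ⟨e, he, rfl⟩
    exact hB e (he.trans ih)

theorem finClosure_mono (hAB : A ⊆ B) : finClosure f A ⊆ finClosure f B :=
  finClosure_subset (hAB.trans subset_finClosure) fun _ => apply_mem_finClosure

theorem Cardinal.mk_finset_lt {α : Type*} {c : Cardinal} (hc : ℵ₀ < c) (h : #α < c) :
    #(Finset α) < c := by
  cases finite_or_infinite α
  · exact (mk_lt_aleph0 (α := Finset α)).trans hc
  · rwa [mk_finset_of_infinite]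

theorem mk_finClosureStage_lt {c : Cardinal} (hc : ℵ₀ < c) (hA : #A < c) (n : ℕ) :
    #(finClosureStage f A n) < c := by
  classical
  induction n with
  | zero => exact hA
  | succ n ih =>
    refine (mk_union_le _ _).trans_lt (add_lt_of_lt hc.le ih ?_)
    refine lt_of_le_of_lt ?_ (mk_finset_lt hc ih)
    let φ : Finset (finClosureStage f A n) → T := fun e => f (e.map (Function.Embedding.subtype _))
    refine (mk_le_mk_of_subset ?_).trans (mk_range_le (f := φ))
    rintro _ ⟨e, he, rfl⟩
    refine ⟨e.subtype (· ∈ finClosureStage f A n), ?_⟩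
    simp only [φ, Finset.subtype_map]
    rw [Finset.filter_true_of_mem fun x hx => he hx]

theorem mk_finClosure_lt {c : Cardinal} (hc : ℵ₀ < c) (hreg : c.IsRegular) (hA : #A < c) :
    #(finClosure f A) < c := by
  have h := mk_iUnion_le_lift (f := finClosureStage f A)
  rw [lift_uzero, mk_nat, lift_aleph0] at h
  refine h.trans_lt (mul_lt_of_lt hc.le hc ?_)
  apply lift_iSup_lt_of_lt_cof_ord
  · simpa [hreg.cof_ord] using hc
  · simpa only [lift_uzero] using mk_finClosureStage_lt hc hA

end finClosure

/-- A strictly increasing sequence of ordinals closed under `g`. -/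
noncomputable def closingSeq (g : Ordinal.{0} → Ordinal.{0}) (i : Ordinal.{0}) : Ordinal.{0} :=
  ⨆ j : Set.Iio i, (max (closingSeq g j) (g (closingSeq g j)) + 1)
termination_by i
decreasing_by exact j.2

theorem max_lt_closingSeq (g : Ordinal.{0} → Ordinal.{0}) {i j : Ordinal.{0}} (h : j < i) :
    max (closingSeq g j) (g (closingSeq g j)) < closingSeq g i := by
  rw [closingSeq.eq_1 g i, Ordinal.lt_iSup_iff]
  exact ⟨⟨j, h⟩, lt_add_one _⟩

theorem closingSeq_strictMono (g : Ordinal.{0} → Ordinal.{0}) : StrictMono (closingSeq g) :=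
  fun _ _ h => (le_max_left _ _).trans_lt (max_lt_closingSeq g h)

theorem closingSeq_lt {g : Ordinal.{0} → Ordinal.{0}} {c : Cardinal.{0}} (hc : c.IsRegular)
    (hg : ∀ b < c.ord, g b < c.ord) {i : Ordinal.{0}} (hi : i < c.ord) :
    closingSeq g i < c.ord := by
  induction i using WellFoundedLT.induction with
  | ind i ih =>
    rw [closingSeq.eq_1]
    apply Ordinal.lift_iSup_add_one_lt_of_lt_cof
    · rw [← Ordinal.lift_cof, hc.cof_ord, mk_Iio_ordinal, lift_uzero]
      exact lift_lt.2 (lt_ord.1 hi)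
    · intro j
      have hj := ih j j.2 (j.2.trans hi)
      exact max_lt hj (hg _ hj)

theorem exists_cof_eq_finClosure_lt {X : Set Ordinal.{0}} (f : Finset X → X)
    {c ν : Cardinal.{0}} (hc : c.IsRegular) (hν : ν.IsRegular) (hνc : ν < c)
    {C : Set X} (hC : #C < Cardinal.lift.{1} c) :
    ∃ β < c.ord, β.cof = ν ∧
      #(finClosure f (C ∪ {a | (a : Ordinal) < β})) < Cardinal.lift.{1} c ∧
      ∀ a ∈ finClosure f (C ∪ {a | (a : Ordinal) < β}), (a : Ordinal) < c.ord →
        (a : Ordinal) < β := by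
  have hc₀ : ℵ₀ < Cardinal.lift.{1} c := by
    simpa using hν.aleph0_le.trans_lt hνc
  let K : Ordinal → Set X := fun b => finClosure f (C ∪ {a | (a : Ordinal) < b})
  have hK_mono : Monotone K := fun b b' h =>
    finClosure_mono (Set.union_subset_union_right _ fun a ha => lt_of_lt_of_le ha h)
  have hK_card : ∀ b < c.ord, #(K b) < Cardinal.lift.{1} c := by
    intro b hb
    refine mk_finClosure_lt hc₀ hc.lift ((mk_union_le _ _).trans_lt (add_lt_of_lt hc₀.le hC ?_))
    have h : #{a : X | (a : Ordinal) < b} ≤ #(Set.Iio b) :=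
      mk_preimage_of_injective _ _ Subtype.val_injective
    refine h.trans_lt ?_
    rw [mk_Iio_ordinal]
    exact lift_lt.2 (lt_ord.1 hb)
  let s : Ordinal → Set Ordinal := fun b => {o | o ∈ Subtype.val '' K b ∧ o < c.ord}
  let g : Ordinal → Ordinal := fun b => sSup ((fun o => o + 1) '' s b)
  have hg : ∀ b < c.ord, g b < c.ord := by
    intro b hb
    refine Ordinal.sSup_add_one_lt_of_lt_cof ?_ fun o ho => ho.2
    rw [← Ordinal.lift_cof, hc.cof_ord]
    exact ((mk_le_mk_of_subset fun o ho => ho.1).trans mk_image_le).trans_lt (hK_card b hb)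
  have hlt_g : ∀ b, ∀ a ∈ K b, (a : Ordinal) < c.ord → (a : Ordinal) < g b := by
    intro b a ha hac
    refine (lt_add_one _).trans_le (le_csSup ⟨c.ord, ?_⟩ ⟨a, ⟨⟨a, ha, rfl⟩, hac⟩, rfl⟩)
    rintro _ ⟨o, ho, rfl⟩
    exact Order.add_one_le_of_lt ho.2
  have hlim : Order.IsSuccLimit ν.ord := isSuccLimit_ord hν.aleph0_le
  have hνc' : ν.ord < c.ord := ord_lt_ord.2 hνc
  let F : Set.Iio ν.ord → Ordinal := fun i => closingSeq g i
  have hF : StrictMono F := fun _ _ h => closingSeq_strictMono g h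
  have hne : Nonempty (Set.Iio ν.ord) := ⟨⟨0, hν.ord_pos⟩⟩
  have hβ : ⨆ i, F i < c.ord := by
    refine lt_of_le_of_lt (Ordinal.iSup_le fun i => ?_) (closingSeq_lt hc hg hνc')
    exact (closingSeq_strictMono g i.2).le
  refine ⟨⨆ i, F i, hβ, ?_, hK_card _ hβ, fun a ha hac => ?_⟩
  · rw [Ordinal.cof_iSup_Iio hF hlim.isSuccPrelimit, hν.cof_ord]
  · have hdir : Directed (· ⊆ ·) fun i => K (F i) :=
      (hK_mono.comp hF.monotone).directed_le
    have hsub : K (⨆ i, F i) ⊆ ⋃ i, K (F i) := by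
      refine finClosure_subset (Set.union_subset ?_ ?_) fun e he => ?_
      · intro a ha
        exact Set.mem_iUnion.2 ⟨hne.some, subset_finClosure (Or.inl ha)⟩
      · intro a ha
        obtain ⟨i, hi⟩ := Ordinal.lt_iSup_iff.1 ha
        exact Set.mem_iUnion.2 ⟨i, subset_finClosure (Or.inr hi)⟩
      · obtain ⟨i, hi⟩ := hdir.exists_mem_subset_of_finset_subset_biUnion he
        exact Set.mem_iUnion.2 ⟨i, apply_mem_finClosure hi⟩
    obtain ⟨i, hi⟩ := Set.mem_iUnion.1 (hsub ha)
    refine Ordinal.lt_iSup_iff.2 ⟨⟨i + 1, hlim.add_one_lt i.2⟩, ?_⟩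
    exact (hlt_g _ a hi hac).trans
      ((le_max_right _ _).trans_lt (max_lt_closingSeq g (lt_add_one i.1)))

/-- Let `κ ≥ ℵ₂` be a regular cardinal, `ν ≠ μ` two infinite regular cardinals below `κ`,
and `X` a set of ordinals containing all ordinals `< κ⁺`.  Then the set
`S = {x ∈ 𝒫_κ(X) : x ∩ κ ∈ E^κ_ν and cf(sup(x ∩ κ⁺)) = μ}` is stationary in `𝒫_κ(X)`:
for every `f : [X]^{<ω} → X` there is an `f`-closed `x ∈ 𝒫_κ(X)` lying in `S`. -/
theorem stationary_of_distinct_cofinalities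
    (κ ν μ : Cardinal.{0}) (hκreg : κ.IsRegular) (hκ : aleph 2 ≤ κ)
    (hνreg : ν.IsRegular) (hμreg : μ.IsRegular) (hνμ : ν ≠ μ)
    (hν : ν < κ) (hμ : μ < κ)
    (X : Set Ordinal.{0}) (hX : ∀ o : Ordinal, o < (Order.succ κ).ord → o ∈ X)
    (f : Finset X → X) :
    ∃ x : Set X,
      #x < Cardinal.lift.{1} κ ∧
      (∀ e : Finset X, ↑e ⊆ x → f e ∈ x) ∧
      (∃ β : Ordinal, β < κ.ord ∧ β.cof = ν ∧
        {a : X | a ∈ x ∧ (a : Ordinal) < κ.ord} = {a : X | (a : Ordinal) < β}) ∧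
      Ordinal.cof
        (sSup {o : Ordinal | o ∈ Subtype.val '' x ∧ o < (Order.succ κ).ord}) = μ := by
  have hκ₀ : ℵ₀ ≤ κ := hκreg.aleph0_le
  have hκκ : κ.ord < (Order.succ κ).ord := ord_lt_ord.2 (Order.lt_succ κ)
  have hmk : ∀ D : Set Ordinal.{0}, #{a : X | (a : Ordinal) ∈ D} ≤ #D := fun D =>
    mk_preimage_of_injective _ D Subtype.val_injective
  obtain ⟨γ, hγ, hγcof, -, hγcl⟩ := exists_cof_eq_finClosure_lt f
    (isRegular_succ hκ₀) hμreg (hμ.trans (Order.lt_succ κ))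
    (C := {a : X | (a : Ordinal) ∈ Set.Iio κ.ord}) <| by
      refine (hmk _).trans_lt ?_
      rw [mk_Iio_ordinal, card_ord]
      exact lift_lt.2 (Order.lt_succ κ)
  have hκγ : κ.ord ≤ γ := by
    by_contra! h
    exact lt_irrefl γ (hγcl ⟨γ, hX γ hγ⟩ (subset_finClosure (Or.inl h)) hγ)
  have hγlim : Order.IsSuccLimit γ := Ordinal.one_lt_cof_iff.1 (hγcof ▸ hμreg.nat_lt 1)
  obtain ⟨D, hD, hDcard⟩ := Order.exists_cof_eq (Set.Iio γ)
  rw [Ordinal.cof_Iio, ← Ordinal.lift_cof, hγcof] at hDcard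
  obtain ⟨β, hβ, hβcof, hcard, hβcl⟩ := exists_cof_eq_finClosure_lt f hκreg hνreg hν
    (C := {a : X | (a : Ordinal) ∈ Subtype.val '' D}) <| by
      refine ((hmk _).trans mk_image_le).trans_lt ?_
      rw [hDcard]
      exact lift_lt.2 hμ
  refine ⟨_, hcard, fun e => apply_mem_finClosure, ⟨β, hβ, hβcof, ?_⟩, ?_⟩
  · ext a
    exact ⟨fun h => hβcl a h.1 h.2, fun h => ⟨subset_finClosure (Or.inr h), lt_trans h hβ⟩⟩
  · rw [← hγcof]
    congr 1
    have hmem : ∀ d ∈ D, d.1 ∈ {o : Ordinal | o ∈ Subtype.val '' finClosure f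
        ({a : X | (a : Ordinal) ∈ Subtype.val '' D} ∪ {a | (a : Ordinal) < β}) ∧
          o < (Order.succ κ).ord} := fun d hd =>
      have hdκ := lt_trans d.2 hγ
      ⟨⟨⟨d.1, hX _ hdκ⟩, subset_finClosure (Or.inl ⟨d, hd, rfl⟩), rfl⟩, hdκ⟩
    refine csSup_eq_of_forall_le_of_forall_lt_exists_gt ?_ ?_ ?_
    · obtain ⟨d, hd, -⟩ := hD ⟨0, hγlim.bot_lt⟩
      exact ⟨_, hmem d hd⟩
    · rintro _ ⟨⟨a, ha, rfl⟩, haκ⟩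
      refine (hγcl a (finClosure_mono ?_ ha) haκ).le
      rintro b (⟨d, -, hd⟩ | hb)
      · exact Or.inr (hd.symm.trans_lt d.2)
      · exact Or.inl (lt_trans hb hβ)
    · intro w hw
      obtain ⟨d, hd, hwd⟩ := hD ⟨w + 1, hγlim.add_one_lt hw⟩
      exact ⟨d.1, hmem d hd, (lt_add_one w).trans_le hwd⟩
end

section
/- Let A and B be complete Boolean algebras, and let A⁺ and B⁺ denote their sets of nonzero elements, partially ordered by the Boolean order and with maximal element ⊤. Then there exists a complete embedding from A⁺ into B⁺ if and only if there exists a projection from B⁺ onto A⁺. -/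
/-- Two elements of a poset are incompatible if no element lies below both. -/
def Incomp {P : Type*} [PartialOrder P] (p q : P) : Prop := ¬ ∃ r : P, r ≤ p ∧ r ≤ q

/-- A maximal antichain in a poset: a set of pairwise incompatible elements such that every
element of the poset is compatible with some member of it. -/
def IsMaximalAntichain {P : Type*} [PartialOrder P] (A : Set P) : Prop :=
  A.Pairwise Incomp ∧ ∀ p : P, ∃ a ∈ A, ¬ Incomp p a

/-- A complete embedding between posets with designated maximal elements `tP`, `tQ`:
it sends `tP` to `tQ`, is order-preserving, preserves incompatibility, and maps maximal
antichains onto maximal antichains. -/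
def IsCompleteEmbedding {P Q : Type*} [PartialOrder P] [PartialOrder Q]
    (tP : P) (tQ : Q) (i : P → Q) : Prop :=
  i tP = tQ ∧ Monotone i ∧ (∀ p q : P, Incomp p q → Incomp (i p) (i q)) ∧
  ∀ A : Set P, IsMaximalAntichain A → IsMaximalAntichain (i '' A)

/-- A projection between posets with designated maximal elements `tQ`, `tP`: it sends `tQ` to
`tP`, is order-preserving, and whenever `a ≤ p b` there is `b' ≤ b` with `p b' ≤ a`. -/
def IsProjection {P Q : Type*} [PartialOrder P] [PartialOrder Q]
    (tP : P) (tQ : Q) (p : Q → P) : Prop :=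
  p tQ = tP ∧ Monotone p ∧ ∀ (a : P) (b : Q), a ≤ p b → ∃ b' : Q, b' ≤ b ∧ p b' ≤ a

section PosetLemmas

variable {P : Type*} [PartialOrder P]

lemma Incomp.symm {p q : P} (h : Incomp p q) : Incomp q p :=
  fun ⟨r, hq, hp⟩ => h ⟨r, hp, hq⟩

/-- Every dense subset of a poset includes a maximal antichain of the poset. -/
lemma exists_isMaximalAntichain_subset_of_dense {D : Set P} (hD : ∀ p, ∃ d ∈ D, d ≤ p) :
    ∃ W ⊆ D, IsMaximalAntichain W := by
  obtain ⟨W, hW⟩ := zorn_subset {W : Set P | W ⊆ D ∧ W.Pairwise Incomp} fun c hc hchain =>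
    ⟨⋃₀ c, ⟨Set.sUnion_subset fun s hs => (hc hs).1,
      (Set.pairwise_sUnion hchain.directedOn).2 fun s hs => (hc hs).2⟩,
      fun s hs => Set.subset_sUnion_of_mem hs⟩
  refine ⟨W, hW.prop.1, hW.prop.2, fun p => ?_⟩
  by_contra! hp
  obtain ⟨d, hd, hdp⟩ := hD p
  have hdW : ∀ w ∈ W, Incomp d w := fun w hw ⟨r, hrd, hrw⟩ => hp w hw ⟨r, hrd.trans hdp, hrw⟩
  have hins : insert d W ∈ {W : Set P | W ⊆ D ∧ W.Pairwise Incomp} :=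
    ⟨Set.insert_subset hd hW.prop.1,
      hW.prop.2.insert fun w hw _ => ⟨hdW w hw, (hdW w hw).symm⟩⟩
  have hmem : d ∈ W := hW.le_of_ge hins (Set.subset_insert d W) (Set.mem_insert d W)
  exact hdW d hmem ⟨d, le_rfl, le_rfl⟩

end PosetLemmas

lemma incomp_iff_disjoint {A : Type*} [BooleanAlgebra A] {p q : {a : A // a ≠ ⊥}} :
    Incomp p q ↔ Disjoint (p : A) q := by
  refine ⟨fun h => ?_, fun h ⟨r, hp, hq⟩ => r.2 (le_bot_iff.1 (h hp hq))⟩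
  rw [disjoint_iff]
  by_contra hne
  exact h ⟨⟨_, hne⟩, Subtype.coe_le_coe.1 inf_le_left, Subtype.coe_le_coe.1 inf_le_right⟩

section Constructions

variable {A B : Type*} [CompleteBooleanAlgebra A] [CompleteBooleanAlgebra B]

/-- The join of all elements whose image under `i` is disjoint from `b`. -/
def disjointJoin (i : {a : A // a ≠ ⊥} → {b : B // b ≠ ⊥}) (b : B) : A :=
  sSup {a | ∃ h : a ≠ ⊥, Disjoint (i ⟨a, h⟩ : B) b}

/-- The join of all elements whose image under `p` is below `a`. -/
def preimageJoin (p : {b : B // b ≠ ⊥} → {a : A // a ≠ ⊥}) (a : A) : B :=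
  sSup {b | ∃ h : b ≠ ⊥, (p ⟨b, h⟩ : A) ≤ a}

lemma disjointJoin_ne_top {i : {a : A // a ≠ ⊥} → {b : B // b ≠ ⊥}}
    (hmono : Monotone i)
    (hmax : ∀ W : Set {a : A // a ≠ ⊥}, IsMaximalAntichain W → IsMaximalAntichain (i '' W))
    (b : {b : B // b ≠ ⊥}) : disjointJoin i b ≠ ⊤ := by
  intro htop
  obtain ⟨W, hWD, hW⟩ := exists_isMaximalAntichain_subset_of_dense
    (D := {a : {a : A // a ≠ ⊥} | Disjoint (i a : B) b}) fun p => by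
      by_contra! hp
      apply p.2
      rw [← disjoint_top, ← htop, disjointJoin, disjoint_sSup_iff]
      rintro a ⟨ha, hab⟩
      rw [disjoint_iff]
      by_contra hne
      refine hp ⟨_, hne⟩ (hab.mono_left ?_) (Subtype.coe_le_coe.1 inf_le_left)
      exact hmono (Subtype.coe_le_coe.1 inf_le_right)
  obtain ⟨_, ⟨w, hw, rfl⟩, hbw⟩ := (hmax W hW).2 b
  exact hbw (incomp_iff_disjoint.2 (hWD hw).symm)

variable [Nontrivial A] [Nontrivial B]

lemma IsCompleteEmbedding.exists_isProjection {i : {a : A // a ≠ ⊥} → {b : B // b ≠ ⊥}}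
    (hi : IsCompleteEmbedding (⟨⊤, top_ne_bot⟩ : {a : A // a ≠ ⊥})
      (⟨⊤, top_ne_bot⟩ : {b : B // b ≠ ⊥}) i) :
    ∃ p : {b : B // b ≠ ⊥} → {a : A // a ≠ ⊥},
      IsProjection (⟨⊤, top_ne_bot⟩ : {a : A // a ≠ ⊥})
        (⟨⊤, top_ne_bot⟩ : {b : B // b ≠ ⊥}) p := by
  obtain ⟨-, hmono, hinc, hmax⟩ := hi
  refine ⟨fun b => ⟨(disjointJoin i b)ᶜ, fun h =>
    disjointJoin_ne_top hmono hmax b (compl_eq_bot.1 h)⟩, ?_, fun b c hbc => ?_, fun a b hab => ?_⟩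
  · refine Subtype.ext (compl_eq_top.2 (sSup_eq_bot.2 ?_))
    rintro a ⟨ha, hd⟩
    exact absurd (disjoint_top.1 hd) (i ⟨a, ha⟩).2
  · refine compl_le_compl (sSup_le_sSup ?_)
    rintro a ⟨ha, hd⟩
    exact ⟨ha, hd.mono_right hbc⟩
  · have hne : (b : B) ⊓ i a ≠ ⊥ := fun h => a.2 <| by
      have hle : (a : A) ≤ disjointJoin i b := le_sSup ⟨a.2, (disjoint_iff.2 h).symm⟩
      exact disjoint_self.1 ((disjoint_compl_right (a := disjointJoin i b)).mono hle hab)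
    refine ⟨⟨_, hne⟩, Subtype.coe_le_coe.1 inf_le_left, ?_⟩
    change (disjointJoin i ((b : B) ⊓ i a))ᶜ ≤ (a : A)
    rw [compl_le_iff_compl_le]
    by_cases ha : (a : A)ᶜ = ⊥
    · simp [ha]
    · refine le_sSup ⟨ha, ?_⟩
      exact (incomp_iff_disjoint.1 (hinc ⟨_, ha⟩ a
        (incomp_iff_disjoint.2 disjoint_compl_left))).mono_right inf_le_right

lemma IsProjection.exists_isCompleteEmbedding {p : {b : B // b ≠ ⊥} → {a : A // a ≠ ⊥}}
    (hp : IsProjection (⟨⊤, top_ne_bot⟩ : {a : A // a ≠ ⊥})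
      (⟨⊤, top_ne_bot⟩ : {b : B // b ≠ ⊥}) p) :
    ∃ i : {a : A // a ≠ ⊥} → {b : B // b ≠ ⊥},
      IsCompleteEmbedding (⟨⊤, top_ne_bot⟩ : {a : A // a ≠ ⊥})
        (⟨⊤, top_ne_bot⟩ : {b : B // b ≠ ⊥}) i := by
  obtain ⟨htop, hmono, hproj⟩ := hp
  have hle {b : {b : B // b ≠ ⊥}} {a : A} (h : (p b : A) ≤ a) : (b : B) ≤ preimageJoin p a :=
    le_sSup ⟨b.2, h⟩
  have hne (a : {a : A // a ≠ ⊥}) : preimageJoin p a ≠ ⊥ := by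
    obtain ⟨b, -, hb⟩ := hproj a ⟨⊤, top_ne_bot⟩
      (by rw [htop]; exact Subtype.coe_le_coe.1 le_top)
    exact ne_bot_of_le_ne_bot b.2 (hle hb)
  have hinc (a c : {a : A // a ≠ ⊥}) (hac : Incomp a c) :
      Disjoint (preimageJoin p a) (preimageJoin p c) := by
    rw [preimageJoin, preimageJoin, sSup_disjoint_iff]
    rintro b ⟨hb, hba⟩
    rw [disjoint_sSup_iff]
    rintro d ⟨hd, hdc⟩
    rw [disjoint_iff]
    by_contra hbd
    exact hac ⟨p ⟨_, hbd⟩,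
      (hmono (Subtype.coe_le_coe.1 inf_le_left : _ ≤ (⟨b, hb⟩ : {b : B // b ≠ ⊥}))).trans hba,
      (hmono (Subtype.coe_le_coe.1 inf_le_right : _ ≤ (⟨d, hd⟩ : {b : B // b ≠ ⊥}))).trans hdc⟩
  refine ⟨fun a => ⟨preimageJoin p a, hne a⟩, ?_, fun a c hac => ?_,
    fun a c hac => incomp_iff_disjoint.2 (hinc a c hac), fun W hW => ⟨?_, fun b => ?_⟩⟩
  · exact Subtype.ext (top_le_iff.1 (hle (b := ⟨⊤, top_ne_bot⟩) le_top))
  · refine sSup_le_sSup ?_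
    rintro b ⟨hb, hba⟩
    exact ⟨hb, hba.trans hac⟩
  · rintro _ ⟨a, ha, rfl⟩ _ ⟨c, hc, rfl⟩ hac
    exact incomp_iff_disjoint.2 (hinc a c (hW.1 ha hc fun h => hac (by rw [h])))
  · obtain ⟨a, ha, hba⟩ := hW.2 (p b)
    obtain ⟨r, hrb, hra⟩ := not_not.1 hba
    obtain ⟨b', hb', hr⟩ := hproj r b hrb
    exact ⟨_, ⟨a, ha, rfl⟩, not_not.2 ⟨b', hb', hle (hr.trans hra)⟩⟩

end Constructions

/-- For complete Boolean algebras `A` and `B`, there is a complete embedding of `A⁺` into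
`B⁺` if and only if there is a projection of `B⁺` onto `A⁺`. -/
theorem completeEmbedding_iff_projection (A B : Type*)
    [CompleteBooleanAlgebra A] [CompleteBooleanAlgebra B] [Nontrivial A] [Nontrivial B] :
    (∃ i : {a : A // a ≠ ⊥} → {b : B // b ≠ ⊥},
      IsCompleteEmbedding (⟨⊤, top_ne_bot⟩ : {a : A // a ≠ ⊥})
        (⟨⊤, top_ne_bot⟩ : {b : B // b ≠ ⊥}) i) ↔
    (∃ p : {b : B // b ≠ ⊥} → {a : A // a ≠ ⊥},
      IsProjection (⟨⊤, top_ne_bot⟩ : {a : A // a ≠ ⊥})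
        (⟨⊤, top_ne_bot⟩ : {b : B // b ≠ ⊥}) p) := by
  exact ⟨fun ⟨_, hi⟩ => hi.exists_isProjection,
    fun ⟨_, hp⟩ => hp.exists_isCompleteEmbedding⟩
end
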